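/- Let A be an integral domain that is subintegrally closed in its field of fractions (i.e., a seminormal domain), and let M be a positive commutative cancellative torsion-free monoid that is subintegrally closed in its group of fractions gp(M) (i.e., a seminormal monoid). Then the Picard group of A is isomorphic to the Picard group of the monoid algebra A[M]: Pic(A) ≅ Pic(A[M]). -/

import Mathlib

open scoped Classical

noncomputable section

open CategoryTheory

universe u v

/-- A commutative monoid is torsion-free. -/
def MulTorsionFree (N : Type*) [CommMonoid N] : Prop :=
  ∀ (x y : N) (n : ℕ), n ≠ 0 → x ^ n = y ^ n → x = y

/-- The Picard group of a commutative ring `R`: the group of isomorphism classes of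
invertible `R`-modules, realized as the units of the (commutative) monoid of isomorphism
classes of `R`-modules under tensor product. -/
def RingPic (R : Type u) [CommRing R] : Type (u + 1) :=
  (Skeleton (ModuleCat.{u} R))ˣ

noncomputable instance (R : Type u) [CommRing R] : CommGroup (RingPic R) :=
  inferInstanceAs (CommGroup (Skeleton (ModuleCat.{u} R))ˣ)

theorem exists_linearOrder_one_le {G : Type*} [CommGroup G] (htf : MulTorsionFree G)
    (M : Submonoid G) (hpos : ∀ x ∈ M, x⁻¹ ∈ M → x = 1) :
    ∃ _ : LinearOrder G, IsOrderedMonoid G ∧ ∀ x ∈ M, 1 ≤ x := by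
  obtain ⟨N, hMN, hN⟩ : ∃ N, M ≤ N ∧ Maximal Submonoid.IsMulPointed N := by
    refine zorn_le_nonempty₀ {N : Submonoid G | N.IsMulPointed} (fun c hc hchain y hy ↦ ?_) M hpos
    have hne : c.Nonempty := ⟨y, hy⟩
    have hdir := hchain.directedOn
    refine ⟨sSup c, fun x hx hx' ↦ ?_, fun z hz ↦ le_sSup hz⟩
    rw [Submonoid.mem_sSup_of_directedOn hne hdir] at hx hx'
    obtain ⟨N₁, h₁, hx⟩ := hx
    obtain ⟨N₂, h₂, hx'⟩ := hx'
    obtain ⟨N₃, h₃, h13, h23⟩ := hdir N₁ h₁ N₂ h₂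
    exact hc h₃ x (h13 hx) (h23 hx')
  have key : ∀ g : G, g ∉ N → ∃ k : ℕ, k ≠ 0 ∧ (g⁻¹) ^ k ∈ N := by
    intro g hg
    by_contra! hk
    have hP : (N ⊔ Submonoid.powers g).IsMulPointed := by
      intro x hx hx'
      obtain ⟨a, ha, _, ⟨n, rfl⟩, rfl⟩ := Submonoid.mem_sup.1 hx
      obtain ⟨b, hb, _, ⟨m, rfl⟩, hm⟩ := Submonoid.mem_sup.1 hx'
      have h1 : a * b = (g⁻¹) ^ (n + m) := by
        dsimp only at hm ⊢
        have : (b * g ^ m) * (a * g ^ n) = 1 := by rw [hm]; simp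
        rw [inv_pow, eq_inv_iff_mul_eq_one, ← this, pow_add]
        ac_rfl
      by_cases h0 : n + m = 0
      · have hn : n = 0 := by omega
        have hm0 : m = 0 := by omega
        subst hn hm0
        simp only [pow_zero, mul_one] at hm ⊢
        exact hN.1 a ha (hm ▸ hb)
      · exact absurd (h1 ▸ mul_mem ha hb) (hk _ h0)
    have := hN.2 hP le_sup_left
    exact hg (this (Submonoid.mem_sup_right (Submonoid.mem_powers g)))
  have hspan : ∀ g : G, g ∈ N ∨ g⁻¹ ∈ N := by
    intro g
    by_contra! h
    obtain ⟨k, hk, hk'⟩ := key g h.1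
    obtain ⟨l, hl, hl'⟩ := key _ h.2
    rw [inv_inv] at hl'
    have h1 : g ^ (l * k) ∈ N := pow_mul g l k ▸ pow_mem hl' k
    have h2 : (g ^ (l * k))⁻¹ ∈ N := by
      rw [← inv_pow, mul_comm, pow_mul]
      exact pow_mem hk' l
    have := hN.1 _ h1 h2
    have : g = 1 := htf _ _ (l * k) (mul_ne_zero hl hk) (by simpa using this)
    exact h.1 (this ▸ one_mem N)
  let C : GroupCone G := { N with eq_one_of_mem_of_inv_mem' := fun {a} ha ha' ↦ hN.1 a ha ha' }
  have : HasMemOrInvMem C := ⟨hspan⟩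
  refine ⟨LinearOrder.mkOfGroupCone C, IsOrderedMonoid.mkOfCone C, fun x hx ↦ ?_⟩
  change x / 1 ∈ N
  simpa using hMN hx

section PicardProof
open MonoidAlgebra

section Support

variable {R : Type*} [CommRing R] {G : Type*} [CommGroup G]

theorem exists_of_coeff_mul_ne_zero {f g : R[G]} {x : G} (h : (f * g).coeff x ≠ 0) :
    ∃ a b, f.coeff a ≠ 0 ∧ g.coeff b ≠ 0 ∧ a * b = x := by
  have := support_coeff_mul_subset f g (Finsupp.mem_support_iff.2 h)
  obtain ⟨a, ha, b, hb, hab⟩ := Finset.mem_mul.1 this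
  exact ⟨a, b, Finsupp.mem_support_iff.1 ha, Finsupp.mem_support_iff.1 hb, hab⟩

variable [LinearOrder G]

theorem exists_min_support {f : R[G]} (hf : f ≠ 0) :
    ∃ a, f.coeff a ≠ 0 ∧ ∀ x, f.coeff x ≠ 0 → a ≤ x := by
  have hne : f.coeff.support.Nonempty := by
    rw [Finsupp.support_nonempty_iff]
    simpa using hf
  exact ⟨_, Finsupp.mem_support_iff.1 (Finset.min'_mem _ hne),
    fun x hx ↦ Finset.min'_le _ _ (Finsupp.mem_support_iff.2 hx)⟩

theorem exists_max_support {f : R[G]} (hf : f ≠ 0) :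
    ∃ a, f.coeff a ≠ 0 ∧ ∀ x, f.coeff x ≠ 0 → x ≤ a := by
  have hne : f.coeff.support.Nonempty := by
    rw [Finsupp.support_nonempty_iff]
    simpa using hf
  exact ⟨_, Finsupp.mem_support_iff.1 (Finset.max'_mem _ hne),
    fun x hx ↦ Finset.le_max' _ _ (Finsupp.mem_support_iff.2 hx)⟩

variable [IsOrderedMonoid G]

theorem coeff_mul_of_forall_le {f g : R[G]} {a b : G} (hf : ∀ x, f.coeff x ≠ 0 → a ≤ x)
    (hg : ∀ x, g.coeff x ≠ 0 → b ≤ x) : (f * g).coeff (a * b) = f.coeff a * g.coeff b := by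
  refine coeff_mul_mul_of_uniqueMul fun x y hx hy h ↦ ?_
  have hx := hf x (Finsupp.mem_support_iff.1 hx)
  have hy := hg y (Finsupp.mem_support_iff.1 hy)
  rcases hx.eq_or_lt with rfl | hx'
  · exact ⟨rfl, mul_left_cancel h⟩
  · exact absurd h.symm (mul_lt_mul_of_lt_of_le hx' hy).ne

theorem coeff_mul_of_forall_ge {f g : R[G]} {a b : G} (hf : ∀ x, f.coeff x ≠ 0 → x ≤ a)
    (hg : ∀ x, g.coeff x ≠ 0 → x ≤ b) : (f * g).coeff (a * b) = f.coeff a * g.coeff b := by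
  refine coeff_mul_mul_of_uniqueMul fun x y hx hy h ↦ ?_
  have hx := hf x (Finsupp.mem_support_iff.1 hx)
  have hy := hg y (Finsupp.mem_support_iff.1 hy)
  rcases hx.eq_or_lt with rfl | hx'
  · exact ⟨rfl, mul_left_cancel h⟩
  · exact absurd h (mul_lt_mul_of_lt_of_le hx' hy).ne

variable (R G) in
/-- The subring of the group algebra of an ordered group of elements supported in degrees
`≥ 1`. -/
def oneLE : Subring R[G] where
  carrier := {f | ∀ x, f.coeff x ≠ 0 → 1 ≤ x}
  mul_mem' {f g} hf hg x hx := by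
    obtain ⟨a, b, ha, hb, rfl⟩ := exists_of_coeff_mul_ne_zero hx
    exact one_le_mul (hf a ha) (hg b hb)
  one_mem' x hx := by
    rw [one_def, coeff_single, Finsupp.single_apply] at hx
    split_ifs at hx with h
    · exact h.le
    · exact absurd rfl hx
  add_mem' {f g} hf hg x hx := by
    by_cases h : f.coeff x = 0
    · exact hg x fun h' ↦ hx (by simp [h, h'])
    · exact hf x h
  zero_mem' x hx := absurd rfl hx
  neg_mem' {f} hf x hx := hf x fun h ↦ hx (by simp [h])

theorem coeff_mul_one_of_mem {f g : R[G]} (hf : f ∈ oneLE R G) (hg : g ∈ oneLE R G) :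
    (f * g).coeff 1 = f.coeff 1 * g.coeff 1 := by
  simpa using coeff_mul_of_forall_le hf hg

/-- If two elements supported in degrees `≥ 1` are inverse to each other, they are constant. -/
theorem eq_single_of_mul_eq_one [IsDomain R] {u w : R[G]} (hu : u ∈ oneLE R G)
    (hw : w ∈ oneLE R G) (h : u * w = 1) : u = single 1 (u.coeff 1) := by
  have hu0 : u ≠ 0 := by rintro rfl; simp at h
  have hw0 : w ≠ 0 := by rintro rfl; simp at h
  obtain ⟨a, ha, ha'⟩ := exists_max_support hu0
  obtain ⟨b, hb, hb'⟩ := exists_max_support hw0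
  have hab := coeff_mul_of_forall_ge ha' hb'
  have hab1 : a * b = 1 := by
    by_contra hne
    rw [h, one_def, coeff_single, Finsupp.single_apply, if_neg (Ne.symm hne)] at hab
    exact mul_ne_zero ha hb hab.symm
  have ha1 : a = 1 := by
    refine le_antisymm ?_ (hu a ha)
    rw [← hab1]
    exact le_mul_of_one_le_right' (hw b hb)
  ext x
  rw [coeff_single, Finsupp.single_apply]
  split_ifs with hx
  · rw [hx]
  · by_contra hne
    exact hx (le_antisymm (hu x hne) (ha1 ▸ ha' x hne))

/-- Rank-one factorizations normalized at the identity are unique. -/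
theorem rankOne_unique [IsDomain R] {ι : Type*} [Fintype ι] {f g f' g' : ι → R[G]}
    (hf : ∀ i, f i ∈ oneLE R G) (hg : ∀ i, g i ∈ oneLE R G)
    (hf' : ∀ i, f' i ∈ oneLE R G) (hg' : ∀ i, g' i ∈ oneLE R G)
    (hfg : ∀ i j, f i * g j = f' i * g' j) (h1 : ∑ i, f i * g i = 1)
    (hg1 : ∀ i, (g i).coeff 1 = (g' i).coeff 1) :
    f = f' ∧ g = g' := by
  have h1' : ∑ i, f' i * g' i = 1 := by simpa only [hfg] using h1
  set w := ∑ i, f i * g' i with hw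
  set w' := ∑ i, f' i * g i with hw'
  have hww : w * w' = 1 := by
    calc w * w' = ∑ i, ∑ j, (f i * g' i) * (f' j * g j) := by rw [hw, hw', Finset.sum_mul_sum]
      _ = ∑ i, ∑ j, (f i * g i) * (f' j * g' j) := by
        refine Finset.sum_congr rfl fun i _ ↦ Finset.sum_congr rfl fun j _ ↦ ?_
        calc (f i * g' i) * (f' j * g j) = (f i * g j) * (f' j * g' i) := by ring
          _ = (f i * g j) * (f j * g i) := by rw [hfg j i]
          _ = (f i * g i) * (f j * g j) := by ring
          _ = _ := by rw [hfg j j]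
      _ = 1 := by rw [← Finset.sum_mul_sum, h1, h1', one_mul]
  have hwm : w ∈ oneLE R G := sum_mem fun i _ ↦ mul_mem (hf i) (hg' i)
  have hwm' : w' ∈ oneLE R G := sum_mem fun i _ ↦ mul_mem (hf' i) (hg i)
  have hw1 : w.coeff 1 = 1 := by
    have : (∑ i, f i * g i).coeff 1 = 1 := by rw [h1]; exact coeff_one_one
    rw [coeff_sum, Finsupp.finsetSum_apply] at this
    rw [hw, coeff_sum, Finsupp.finsetSum_apply, ← this]
    refine Finset.sum_congr rfl fun i _ ↦ ?_
    rw [coeff_mul_one_of_mem (hf i) (hg' i), coeff_mul_one_of_mem (hf i) (hg i), hg1]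
  have hwone : w = 1 := by
    rw [eq_single_of_mul_eq_one hwm hwm' hww, hw1, one_def]
  have hw'one : w' = 1 := by rwa [hwone, one_mul] at hww
  constructor
  · funext i
    calc f i = f i * w' := by rw [hw'one, mul_one]
      _ = ∑ j, f' j * (f i * g j) := by
        rw [hw', Finset.mul_sum]; exact Finset.sum_congr rfl fun j _ ↦ by ring
      _ = f' i * ∑ j, f' j * g' j := by
        rw [Finset.mul_sum]; exact Finset.sum_congr rfl fun j _ ↦ by rw [hfg]; ring
      _ = f' i := by rw [h1', mul_one]
  · funext i
    calc g i = g i * w := by rw [hwone, mul_one]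
      _ = ∑ j, g' j * (f j * g i) := by
        rw [hw, Finset.mul_sum]; exact Finset.sum_congr rfl fun j _ ↦ by ring
      _ = g' i * ∑ j, f' j * g' j := by
        rw [Finset.mul_sum]; exact Finset.sum_congr rfl fun j _ ↦ by rw [hfg]; ring
      _ = g' i := by rw [h1', mul_one]

end Support

section Factorization

theorem uniqueFactorizationMonoid_addMonoidAlgebra_fin (L : Type*) [Field L] (n : ℕ) :
    UniqueFactorizationMonoid (AddMonoidAlgebra L (Fin n → ℤ)) := by
  induction n with
  | zero =>
    exact (AddMonoidAlgebra.uniqueRingEquiv (R := L) (Fin 0 → ℤ)).symm.toMulEquiv.uniqueFactorizationMonoid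
      inferInstance
  | succ n ih =>
    have h : UniqueFactorizationMonoid (LaurentPolynomial (AddMonoidAlgebra L (Fin n → ℤ))) :=
      UniqueFactorizationMonoid.of_isLocalization
        (Submonoid.powers (Polynomial.X : Polynomial (AddMonoidAlgebra L (Fin n → ℤ)))) _
    let e₁ : AddMonoidAlgebra L (ℤ × (Fin n → ℤ)) ≃+* AddMonoidAlgebra L (Fin (n + 1) → ℤ) :=
      AddMonoidAlgebra.mapDomainRingEquiv L
        (Fin.consLinearEquiv ℤ (fun _ : Fin (n + 1) ↦ ℤ)).toAddEquiv
    let e₂ : AddMonoidAlgebra L (ℤ × (Fin n → ℤ)) ≃+*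
        LaurentPolynomial (AddMonoidAlgebra L (Fin n → ℤ)) := AddMonoidAlgebra.curryRingEquiv
    exact (e₂.symm.trans e₁).toMulEquiv.uniqueFactorizationMonoid h

theorem uniqueFactorizationMonoid_monoidAlgebra (L : Type*) [Field L] (H : Type*) [CommGroup H]
    [IsMulTorsionFree H] [Group.FG H] : UniqueFactorizationMonoid L[H] := by
  have : Module.Finite ℤ (Additive H) := Module.Finite.iff_addGroup_fg.2 inferInstance
  have : Module.Free ℤ (Additive H) := inferInstance
  let e := AddMonoidAlgebra.mapDomainRingEquiv L
    (Module.finBasis ℤ (Additive H)).equivFun.toAddEquiv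
  exact ((toAdditive L H).trans e).symm.toMulEquiv.uniqueFactorizationMonoid
    (uniqueFactorizationMonoid_addMonoidAlgebra_fin L _)

theorem exists_rankOne_factorization_of_ufm {D : Type*} [CommRing D] [IsDomain D]
    [UniqueFactorizationMonoid D] {ι : Type*} [Fintype ι] (e : ι → ι → D)
    (he : ∀ i j k l, e i j * e k l = e i l * e k j) (h1 : ∑ i, e i i = 1) :
    ∃ f g : ι → D, ∀ i j, e i j = f i * g j := by
  obtain ⟨i₀, -, hi₀⟩ := Finset.exists_ne_zero_of_sum_ne_zero (h1 ▸ one_ne_zero)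
  let := Classical.arbitrary (NormalizedGCDMonoid D)
  obtain ⟨f, hf, hf1⟩ := Finset.extract_gcd (fun i ↦ e i i₀) (s := Finset.univ)
    ⟨i₀, Finset.mem_univ _⟩
  set d := Finset.univ.gcd fun i ↦ e i i₀
  have hd : d ≠ 0 := by
    intro h
    apply hi₀
    rw [hf i₀ (Finset.mem_univ _), h, zero_mul]
  have hdvd : ∀ j, e i₀ i₀ ∣ d * e i₀ j := by
    intro j
    have : e i₀ i₀ ∣ Finset.univ.gcd fun i ↦ e i₀ j * e i i₀ :=
      Finset.dvd_gcd fun i _ ↦ ⟨e i j, by rw [mul_comm, he]; ring⟩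
    rw [mul_comm]
    exact this.trans (Finset.gcd_mul_left' _ _ _).dvd
  choose g hg using hdvd
  refine ⟨f, g, fun i j ↦ mul_left_cancel₀ (mul_ne_zero hd hi₀) ?_⟩
  calc d * e i₀ i₀ * e i j = d * (e i j * e i₀ i₀) := by ring
    _ = d * (e i i₀ * e i₀ j) := by rw [he]
    _ = e i i₀ * (d * e i₀ j) := by ring
    _ = d * f i * (e i₀ i₀ * g j) := by rw [hg, hf i (Finset.mem_univ _)]
    _ = _ := by ring

theorem exists_rankOne_factorization {L : Type*} [Field L] {G : Type*} [CommGroup G]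
    [IsMulTorsionFree G] {ι : Type*} [Fintype ι] (e : ι → ι → L[G])
    (he : ∀ i j k l, e i j * e k l = e i l * e k j) (h1 : ∑ i, e i i = 1) :
    ∃ f g : ι → L[G], ∀ i j, e i j = f i * g j := by
  let S : Finset G := Finset.univ.biUnion fun i ↦ Finset.univ.biUnion fun j ↦
    (e i j).coeff.support
  let H := Subgroup.closure (S : Set G)
  have : Group.FG H := (Group.fg_iff_subgroup_fg H).2 ⟨S, rfl⟩
  have hinj : Function.Injective (mapDomainRingHom L H.subtype) :=
    mapDomain_injective H.subtype_injective
  have hr : ∀ i j, ∃ e', mapDomainRingHom L H.subtype e' = e i j := by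
    intro i j
    refine ⟨comapDomain H.subtype H.subtype_injective (e i j),
      mapDomain_comapDomain (fun x hx ↦ ?_) _⟩
    refine ⟨⟨x, Subgroup.subset_closure ?_⟩, rfl⟩
    simp only [S, Finset.coe_biUnion, Set.mem_iUnion]
    exact ⟨i, by simp, j, by simp, hx⟩
  choose e' he' using hr
  have : UniqueFactorizationMonoid L[H] := uniqueFactorizationMonoid_monoidAlgebra L H
  have : UniqueProds H := inferInstance
  obtain ⟨f, g, hfg⟩ := exists_rankOne_factorization_of_ufm e'
    (fun i j k l ↦ hinj (by simp only [map_mul, he', he i j k l]))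
    (hinj (by simp only [map_sum, he', h1, map_one]))
  exact ⟨fun i ↦ mapDomainRingHom L H.subtype (f i), fun i ↦ mapDomainRingHom L H.subtype (g i),
    fun i j ↦ by rw [← he', hfg, map_mul]⟩

end Factorization

section Normalized

variable {L : Type*} [Field L] {G : Type*} [CommGroup G] {ι : Type*} [Fintype ι]

theorem coeff_sum_diag_eq_one {e : ι → ι → L[G]} {a b : ι → L}
    (hab : ∀ i j, (e i j).coeff 1 = a i * b j) (h1 : ∑ i, e i i = 1) : ∑ i, a i * b i = 1 := by
  have : (∑ i, e i i).coeff 1 = 1 := by rw [h1]; exact coeff_one_one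
  rw [coeff_sum, Finsupp.finsetSum_apply] at this
  simpa only [hab] using this

variable [LinearOrder G] [IsOrderedMonoid G]

/-- Shifting a factorization so that the first factor has lowest degree `1`. -/
theorem exists_oneLE_factorization (e : ι → ι → L[G]) (hsupp : ∀ i j, e i j ∈ oneLE L G)
    (he : ∀ i j k l, e i j * e k l = e i l * e k j) (h1 : ∑ i, e i i = 1) :
    ∃ f g : ι → L[G], (∀ i, f i ∈ oneLE L G) ∧ (∀ i, g i ∈ oneLE L G) ∧
      ∀ i j, e i j = f i * g j := by
  have : IsMulTorsionFree G := inferInstance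
  obtain ⟨f, g, hfg⟩ := exists_rankOne_factorization e he h1
  let S : Finset G := Finset.univ.biUnion fun i ↦ (f i).coeff.support
  have hS : ∀ x, x ∈ S ↔ ∃ i, (f i).coeff x ≠ 0 := by simp [S]
  have hne : S.Nonempty := by
    obtain ⟨i, -, hi⟩ := Finset.exists_ne_zero_of_sum_ne_zero (h1 ▸ one_ne_zero)
    rw [hfg] at hi
    obtain ⟨x, hx, -⟩ := exists_min_support (left_ne_zero_of_mul hi)
    exact ⟨x, (hS x).2 ⟨i, hx⟩⟩
  set v := S.min' hne
  obtain ⟨i₀, hi₀⟩ := (hS v).1 (S.min'_mem hne)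
  have hv : ∀ i x, (f i).coeff x ≠ 0 → v ≤ x := fun i x hx ↦ S.min'_le _ ((hS x).2 ⟨i, hx⟩)
  refine ⟨fun i ↦ single v⁻¹ 1 * f i, fun i ↦ single v 1 * g i, fun i x hx ↦ ?_, fun j x hx ↦ ?_,
    fun i j ↦ ?_⟩
  · rw [coeff_single_mul_apply, one_mul, inv_inv] at hx
    exact le_mul_iff_one_le_right' v |>.1 (hv i _ hx)
  · rw [coeff_single_mul_apply, one_mul] at hx
    have hg : g j ≠ 0 := by
      intro h
      simp [h] at hx
    obtain ⟨b, hb, hb'⟩ := exists_min_support hg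
    have hvb := coeff_mul_of_forall_le (hv i₀) hb'
    have : 1 ≤ v * b := by
      apply hsupp i₀ j
      rw [hfg, hvb]
      exact mul_ne_zero hi₀ hb
    calc 1 ≤ v * b := this
      _ ≤ v * (v⁻¹ * x) := by gcongr; exact hb' _ hx
      _ = x := by simp
  · rw [hfg, mul_mul_mul_comm, single_mul_single, inv_mul_cancel, one_mul, ← one_def, one_mul]

theorem exists_normalized_factorization (e : ι → ι → L[G]) (hsupp : ∀ i j, e i j ∈ oneLE L G)
    (he : ∀ i j k l, e i j * e k l = e i l * e k j) (h1 : ∑ i, e i i = 1) {a b : ι → L}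
    (hab : ∀ i j, (e i j).coeff 1 = a i * b j) :
    ∃ f g : ι → L[G], (∀ i, f i ∈ oneLE L G) ∧ (∀ i, g i ∈ oneLE L G) ∧
      (∀ i j, e i j = f i * g j) ∧ (∀ i, (f i).coeff 1 = a i) ∧ ∀ i, (g i).coeff 1 = b i := by
  obtain ⟨f, g, hf, hg, hfg⟩ := exists_oneLE_factorization e hsupp he h1
  have hab1 := coeff_sum_diag_eq_one hab h1
  have h : ∀ i j, (f i).coeff 1 * (g j).coeff 1 = a i * b j := fun i j ↦ by
    rw [← coeff_mul_one_of_mem (hf i) (hg j), ← hfg, hab]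
  set s := ∑ j, (g j).coeff 1 * a j with hs
  set t := ∑ j, (f j).coeff 1 * b j with ht
  have hfs : ∀ i, s * (f i).coeff 1 = a i := fun i ↦ by
    calc s * (f i).coeff 1 = ∑ j, ((f i).coeff 1 * (g j).coeff 1) * a j := by
          rw [hs, Finset.sum_mul]; exact Finset.sum_congr rfl fun j _ ↦ by ring
      _ = a i * ∑ j, a j * b j := by
          rw [Finset.mul_sum]; exact Finset.sum_congr rfl fun j _ ↦ by rw [h]; ring
      _ = a i := by rw [hab1, mul_one]
  have hgt : ∀ i, t * (g i).coeff 1 = b i := fun i ↦ by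
    calc t * (g i).coeff 1 = ∑ j, ((f j).coeff 1 * (g i).coeff 1) * b j := by
          rw [ht, Finset.sum_mul]; exact Finset.sum_congr rfl fun j _ ↦ by ring
      _ = b i * ∑ j, a j * b j := by
          rw [Finset.mul_sum]; exact Finset.sum_congr rfl fun j _ ↦ by rw [h]; ring
      _ = b i := by rw [hab1, mul_one]
  have hst : s * t = 1 := by
    rw [ht, Finset.mul_sum, ← hab1]
    exact Finset.sum_congr rfl fun j _ ↦ by rw [← mul_assoc, hfs]
  have hconst : ∀ c : L, single (1 : G) c ∈ oneLE L G := fun c x hx ↦ by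
    rw [coeff_single, Finsupp.single_apply] at hx
    split_ifs at hx with h
    · exact h.le
    · exact absurd rfl hx
  refine ⟨fun i ↦ single 1 s * f i, fun i ↦ single 1 t * g i, fun i ↦ mul_mem (hconst _) (hf i),
    fun i ↦ mul_mem (hconst _) (hg i), fun i j ↦ ?_, fun i ↦ ?_, fun i ↦ ?_⟩
  · rw [hfg, mul_mul_mul_comm, single_mul_single, one_mul, hst, ← one_def, one_mul]
  · rw [coeff_mul_one_of_mem (hconst s) (hf i), ← hfs, coeff_single, Finsupp.single_eq_same]
  · rw [coeff_mul_one_of_mem (hconst t) (hg i), ← hgt, coeff_single, Finsupp.single_eq_same]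

end Normalized

section Integrality

variable {G : Type*} [CommGroup G]

theorem exists_primitive_part {K : Type*} [Field K] (V : ValuationSubring K) {F : K[G]}
    (hF : F ≠ 0) : ∃ c : K, c ≠ 0 ∧ (∀ x, V.valuation (F.coeff x) ≤ V.valuation c) ∧
      ∃ F' : V[G], F = single 1 c * mapRingHom G V.subtype F' ∧
        mapRingHom G (IsLocalRing.residue V) F' ≠ 0 := by
  have hne : F.coeff.support.Nonempty := by
    rw [Finsupp.support_nonempty_iff]
    simpa using hF
  obtain ⟨x₀, hx₀, hmax⟩ := F.coeff.support.exists_max_image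
    (fun x ↦ V.valuation (F.coeff x)) hne
  have hc : F.coeff x₀ ≠ 0 := Finsupp.mem_support_iff.1 hx₀
  have hle : ∀ x, V.valuation (F.coeff x) ≤ V.valuation (F.coeff x₀) := by
    intro x
    by_cases hx : F.coeff x = 0
    · simp [hx]
    · exact hmax x (Finsupp.mem_support_iff.2 hx)
  refine ⟨F.coeff x₀, hc, hle, ?_⟩
  have hmem : single 1 (F.coeff x₀)⁻¹ * F ∈ Set.range (MonoidAlgebra.map (M := G)
      (V.subtype : V →+ K)) := by
    rw [range_map]
    intro x
    have hx : (F.coeff x₀)⁻¹ * F.coeff x ∈ V := by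
      rw [← V.valuation_le_one_iff, map_mul, map_inv₀, mul_comm, ← div_eq_mul_inv]
      exact div_le_one_of_le₀ (hle x) zero_le
    rw [coeff_single_mul_apply, inv_one, one_mul]
    exact ⟨⟨_, hx⟩, rfl⟩
  obtain ⟨F', hF'⟩ := hmem
  replace hF' : mapRingHom G V.subtype F' = single 1 (F.coeff x₀)⁻¹ * F := hF'
  refine ⟨F', ?_, fun h ↦ ?_⟩
  · rw [hF', ← mul_assoc, single_mul_single, one_mul, mul_inv_cancel₀ hc, ← one_def, one_mul]
  · have h1 : F'.coeff x₀ = 1 := by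
      have := congrArg (fun f : K[G] ↦ f.coeff x₀) hF'
      simp only [coeff_mapRingHom, coeff_single_mul_apply, inv_one, one_mul,
        inv_mul_cancel₀ hc] at this
      exact Subtype.ext this
    have := congrArg (fun f ↦ f.coeff x₀) h
    simp [h1] at this

variable [UniqueProds G]

/-- A form of Gauss's lemma for valuation rings. -/
theorem coeff_mem_valuationSubring {K : Type*} [Field K] (V : ValuationSubring K) {F H : K[G]}
    {x₀ : G} (hF : F.coeff x₀ = 1) (hFH : ∀ x, (F * H).coeff x ∈ V) (x : G) :
    H.coeff x ∈ V := by
  by_contra hx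
  have hF0 : F ≠ 0 := by
    rintro rfl
    simp at hF
  have hH0 : H ≠ 0 := by
    rintro rfl
    exact hx (by simp)
  obtain ⟨c, hc, hcmax, F', hF', hF'0⟩ := exists_primitive_part V hF0
  obtain ⟨d, hd, hdmax, H', hH', hH'0⟩ := exists_primitive_part V hH0
  have hvc : 1 ≤ V.valuation c := by simpa [hF] using hcmax x₀
  have hvd : 1 < V.valuation d := by
    rw [← V.valuation_le_one_iff, not_le] at hx
    exact hx.trans_le (hdmax x)
  refine mul_ne_zero hF'0 hH'0 ?_
  rw [← map_mul]
  ext y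
  rw [coeff_mapRingHom, coeff_zero, Finsupp.zero_apply, IsLocalRing.residue_eq_zero_iff,
    V.valuation_lt_one_iff]
  have h : F * H = single 1 (c * d) * mapRingHom G V.subtype (F' * H') := by
    rw [hF', hH', mul_mul_mul_comm, single_mul_single, one_mul, map_mul]
  have hy := hFH y
  rw [h, coeff_single_mul_apply, inv_one, one_mul, coeff_mapRingHom, ← V.valuation_le_one_iff,
    map_mul, map_mul] at hy
  have hcd : 1 < V.valuation c * V.valuation d := one_lt_mul_of_le_of_lt hvc hvd
  by_contra! hle
  exact absurd hy (not_le.2 (hcd.trans_le (le_mul_of_one_le_right' hle)))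

theorem isIntegral_coeff_of_mul {R S : Type*} [CommRing R] [CommRing S] [IsDomain S]
    [Algebra R S] {F H : S[G]} {x₀ : G} (hF : F.coeff x₀ = 1)
    (hFH : ∀ x, (F * H).coeff x ∈ (algebraMap R S).range) (x : G) :
    IsIntegral R (H.coeff x) := by
  let K := FractionRing S
  let T : Subring K := (algebraMap R K).range
  let : Algebra R T := (algebraMap R K).rangeRestrict.toAlgebra
  have : IsScalarTower R T K := .of_algebraMap_eq fun _ ↦ rfl
  have hT : Algebra.IsIntegral R T := ⟨fun z ↦ by
    obtain ⟨r, rfl⟩ := (algebraMap R K).rangeRestrict_surjective z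
    exact isIntegral_algebraMap⟩
  rw [← isIntegral_algebraMap_iff (IsFractionRing.injective S K)]
  suffices IsIntegral T (algebraMap S K (H.coeff x)) from isIntegral_trans _ this
  have hcl : Subring.closure (T : Set K) = T := Subring.closure_eq T
  suffices h : algebraMap S K (H.coeff x) ∈
      (⨅ V : {V : ValuationSubring K // (T : Set K) ⊆ V.toSubring}, V.1.toSubring) by
    rw [iInf_valuationSubring_superset, hcl] at h
    exact h
  refine Subring.mem_iInf.2 fun V ↦ ?_
  have := coeff_mem_valuationSubring V.1 (F := mapRingHom G (algebraMap S K) F)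
    (H := mapRingHom G (algebraMap S K) H) (x₀ := x₀) (by simp [hF]) (fun y ↦ ?_) x
  · simpa using this
  · obtain ⟨r, hr⟩ := hFH y
    rw [← map_mul, coeff_mapRingHom, ← hr, ← IsScalarTower.algebraMap_apply]
    exact V.2 ⟨r, rfl⟩

end Integrality

section Conductor

variable {R B : Type*} [CommRing R] [CommRing B] [Algebra R B]

variable (R B) in
/-- The conductor of `R → B`, as an ideal of `B`. -/
def conductorIdeal : Ideal B where
  carrier := {b | ∀ d, b * d ∈ (algebraMap R B).range}
  add_mem' {x y} hx hy d := by
    rw [add_mul]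
    exact add_mem (hx d) (hy d)
  zero_mem' d := by
    rw [zero_mul]
    exact zero_mem _
  smul_mem' c x hx d := by
    rw [smul_eq_mul, mul_comm c, mul_assoc]
    exact hx _

theorem exists_mul_mem_conductorIdeal
    (hrad : ∀ (y : B) (n : ℕ), y ^ n ∈ conductorIdeal R B → y ∈ conductorIdeal R B)
    {p : Ideal R} [p.IsPrime] (hp : p ∈ ((conductorIdeal R B).comap (algebraMap R B)).minimalPrimes)
    {y : B} (hy : ∀ q : Ideal B, q.IsPrime → q.comap (algebraMap R B) = p → y ∈ q) :
    ∃ t ∉ p, algebraMap R B t * y ∈ conductorIdeal R B := by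
  by_contra! hne
  let N : Submonoid B := p.primeCompl.map (algebraMap R B) ⊔ Submonoid.powers y
  have hdisj : Disjoint (conductorIdeal R B : Set B) N := by
    refine Set.disjoint_left.2 fun z hz hzN ↦ ?_
    obtain ⟨_, ⟨t, ht, rfl⟩, _, ⟨n, rfl⟩, rfl⟩ := Submonoid.mem_sup.1 hzN
    refine hne t ht (hrad _ (n + 1) ?_)
    have : (algebraMap R B t * y) ^ (n + 1) =
        (algebraMap R B t ^ n * y) * (algebraMap R B t * y ^ n) := by ring
    rw [this]
    exact Ideal.mul_mem_left _ _ hz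
  obtain ⟨q, hq, hcq, hqN⟩ := Ideal.exists_le_prime_disjoint _ _ hdisj
  have hyN : y ∈ N := (le_sup_right : _ ≤ N) (Submonoid.mem_powers y)
  refine Set.disjoint_left.1 hqN (hy q hq ?_) hyN
  have hle : q.comap (algebraMap R B) ≤ p := by
    intro t ht
    by_contra htp
    exact Set.disjoint_left.1 hqN ht ((le_sup_left : _ ≤ N) ⟨t, htp, rfl⟩)
  exact le_antisymm hle (hp.2 ⟨inferInstance, Ideal.comap_mono hcq⟩ hle)

theorem algebraMap_surjective_of_conductorIdeal
    (hrad : ∀ (y : B) (n : ℕ), y ^ n ∈ conductorIdeal R B → y ∈ conductorIdeal R B)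
    {s : Set B} (hs : s.Finite) (hadj : Algebra.adjoin R s = ⊤) (hint : ∀ b ∈ s, IsIntegral R b)
    (hgen : ∀ p : Ideal R, p.IsPrime → ∀ b ∈ s, ∃ t ∉ p, ∃ r, ∀ q : Ideal B, q.IsPrime →
      q.comap (algebraMap R B) = p → algebraMap R B t * b - algebraMap R B r ∈ q) :
    Function.Surjective (algebraMap R B) := by
  suffices h : (conductorIdeal R B).comap (algebraMap R B) = ⊤ by
    intro d
    have h1 : (1 : R) ∈ (conductorIdeal R B).comap (algebraMap R B) := h ▸ Submodule.mem_top
    rw [Ideal.mem_comap, map_one] at h1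
    simpa using h1 d
  by_contra hne
  obtain ⟨m, hm, hcm⟩ := Ideal.exists_le_maximal _ hne
  obtain ⟨p, hpmin, -⟩ := Ideal.exists_minimalPrimes_le hcm
  have hp : p.IsPrime := hpmin.1.1
  have hloc : ∀ b : B, ∃ t ∉ p, algebraMap R B t * b ∈ (algebraMap R B).range := by
    intro b
    have hb : b ∈ Algebra.adjoin R s := hadj ▸ Algebra.mem_top
    induction hb using Algebra.adjoin_induction with
    | mem b hb =>
      obtain ⟨t, ht, r, hr⟩ := hgen p hp b hb
      obtain ⟨t', ht', h⟩ := exists_mul_mem_conductorIdeal hrad hpmin hr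
      refine ⟨t' * t, hp.mul_notMem ht' ht, ?_⟩
      obtain ⟨z, hz⟩ := h 1
      refine ⟨z + t' * r, ?_⟩
      rw [map_add, hz, map_mul, map_mul]
      ring
    | algebraMap r => exact ⟨1, hp.one_notMem, r, by simp⟩
    | add x y _ _ hx hy =>
      obtain ⟨t, ht, r, hr⟩ := hx
      obtain ⟨t', ht', r', hr'⟩ := hy
      refine ⟨t * t', hp.mul_notMem ht ht', t' * r + t * r', ?_⟩
      rw [map_add, map_mul, map_mul, map_mul, hr, hr']
      ring
    | mul x y _ _ hx hy =>
      obtain ⟨t, ht, r, hr⟩ := hx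
      obtain ⟨t', ht', r', hr'⟩ := hy
      refine ⟨t * t', hp.mul_notMem ht ht', r * r', ?_⟩
      rw [map_mul, map_mul, hr, hr']
      ring
  have hfin : Module.Finite R B := by
    have := Algebra.finite_adjoin_of_finite_of_isIntegral hs hint
    rw [hadj] at this
    exact Module.Finite.equiv (Subalgebra.topEquiv (R := R) (A := B)).toLinearEquiv
  obtain ⟨S, hS⟩ := hfin.fg_top
  choose t ht htr using hloc
  have htS : ∏ b ∈ S, t b ∉ p := by
    rw [hp.prod_mem_iff]
    rintro ⟨b, -, hb⟩
    exact ht b hb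
  refine htS (hpmin.1.2 ?_)
  intro d
  have hd : d ∈ Submodule.span R (S : Set B) := hS ▸ Submodule.mem_top
  induction hd using Submodule.span_induction with
  | mem d hd =>
    obtain ⟨r, hr⟩ := htr d
    refine ⟨(∏ b ∈ S.erase d, t b) * r, ?_⟩
    rw [map_mul, hr, ← mul_assoc, ← map_mul, Finset.prod_erase_mul _ _ hd]
  | zero => simp
  | add x y _ _ hx hy =>
    rw [mul_add]
    exact add_mem hx hy
  | smul a x _ hx =>
    rw [Algebra.smul_def, mul_left_comm]
    exact mul_mem ⟨a, rfl⟩ hx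

end Conductor

section Descent

variable {G : Type*} [CommGroup G] [LinearOrder G] [IsOrderedMonoid G]

theorem map_mem_oneLE {R S : Type*} [CommRing R] [CommRing S] (φ : R →+* S) {f : R[G]}
    (hf : f ∈ oneLE R G) : mapRingHom G φ f ∈ oneLE S G := fun x hx ↦ hf x fun h ↦ hx (by simp [h])

variable {R B ι : Type*} [CommRing R] [CommRing B] [Algebra R B] [Fintype ι]

theorem exists_coeff_sub_mem {E : ι → ι → R[G]} {F H : ι → B[G]} {a b : ι → R}
    (hEs : ∀ i j, E i j ∈ oneLE R G) (hEr : ∀ i j k l, E i j * E k l = E i l * E k j)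
    (hE1 : ∑ i, E i i = 1) (hEab : ∀ i j, (E i j).coeff 1 = a i * b j)
    (hF : ∀ i, F i ∈ oneLE B G) (hH : ∀ i, H i ∈ oneLE B G)
    (hE : ∀ i j, mapRingHom G (algebraMap R B) (E i j) = F i * H j)
    (hHb : ∀ i, (H i).coeff 1 = algebraMap R B (b i)) (p : Ideal R) (hp : p.IsPrime) :
    (∀ i x, ∃ t ∉ p, ∃ r, ∀ q : Ideal B, q.IsPrime → q.comap (algebraMap R B) = p →
      algebraMap R B t * (F i).coeff x - algebraMap R B r ∈ q) ∧
    (∀ i x, ∃ t ∉ p, ∃ r, ∀ q : Ideal B, q.IsPrime → q.comap (algebraMap R B) = p →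
      algebraMap R B t * (H i).coeff x - algebraMap R B r ∈ q) := by
  let L := FractionRing (R ⧸ p)
  let π : R →+* L := (algebraMap (R ⧸ p) L).comp (Ideal.Quotient.mk p)
  obtain ⟨f, g, hf, hg, hfg, hfa, hgb⟩ := exists_normalized_factorization
    (fun i j ↦ mapRingHom G π (E i j)) (fun i j ↦ map_mem_oneLE π (hEs i j))
    (fun i j k l ↦ by rw [← map_mul, hEr, map_mul]) (by rw [← map_sum, hE1, map_one])
    (a := fun i ↦ π (a i)) (b := fun i ↦ π (b i))
    (fun i j ↦ by rw [coeff_mapRingHom, hEab, map_mul])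
  have hfrac : ∀ z : L, ∃ t ∉ p, ∃ r, π t * z = π r := by
    intro z
    obtain ⟨r, t, ht, rfl⟩ := IsFractionRing.div_surjective (A := R ⧸ p) z
    obtain ⟨r, rfl⟩ := Ideal.Quotient.mk_surjective r
    obtain ⟨t, rfl⟩ := Ideal.Quotient.mk_surjective t
    have ht0 : algebraMap (R ⧸ p) L (Ideal.Quotient.mk p t) ≠ 0 :=
      IsFractionRing.to_map_ne_zero_of_mem_nonZeroDivisors ht
    refine ⟨t, fun h ↦ ht0 ?_, r, mul_div_cancel₀ _ ht0⟩
    rw [Ideal.Quotient.eq_zero_iff_mem.2 h, map_zero]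
  have key : ∀ q : Ideal B, q.IsPrime → q.comap (algebraMap R B) = p →
      ∃ (K : Type _) (_ : Field K) (ψ : B →+* K) (φ : L →+* K), (∀ y, ψ y = 0 → y ∈ q) ∧
        (∀ r, ψ (algebraMap R B r) = φ (π r)) ∧
        (∀ i x, ψ ((F i).coeff x) = φ ((f i).coeff x)) ∧
        ∀ i x, ψ ((H i).coeff x) = φ ((g i).coeff x) := by
    intro q hq hqp
    let K := FractionRing (B ⧸ q)
    let ψ : B →+* K := (algebraMap (B ⧸ q) K).comp (Ideal.Quotient.mk q)
    have hψ : ∀ y, ψ y = 0 ↔ y ∈ q := fun y ↦ by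
      simp only [ψ, RingHom.comp_apply, FaithfulSMul.algebraMap_eq_zero_iff,
        Ideal.Quotient.eq_zero_iff_mem]
    let φ₀ : R ⧸ p →+* K := Ideal.Quotient.lift p (ψ.comp (algebraMap R B)) fun r hr ↦ by
      rw [← hqp] at hr
      exact (hψ _).2 hr
    have hφ₀ : Function.Injective φ₀ := by
      rw [injective_iff_map_eq_zero]
      intro z hz
      obtain ⟨r, rfl⟩ := Ideal.Quotient.mk_surjective z
      rw [Ideal.Quotient.lift_mk] at hz
      rw [Ideal.Quotient.eq_zero_iff_mem, ← hqp]
      exact (hψ _).1 hz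
    let φ : L →+* K := IsFractionRing.lift hφ₀
    have hφ : ∀ r, ψ (algebraMap R B r) = φ (π r) := fun r ↦ by
      simp only [φ, π, RingHom.comp_apply, IsFractionRing.lift_algebraMap]
      rw [Ideal.Quotient.lift_mk]
      rfl
    have hEK : ∀ i j, mapRingHom G ψ (F i) * mapRingHom G ψ (H j) =
        mapRingHom G φ (f i) * mapRingHom G φ (g j) := fun i j ↦ by
      rw [← map_mul, ← map_mul, ← hE, ← hfg]
      ext x
      simp only [coeff_mapRingHom, hφ]
    obtain ⟨h1, h2⟩ := rankOne_unique (fun i ↦ map_mem_oneLE ψ (hF i))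
      (fun i ↦ map_mem_oneLE ψ (hH i)) (fun i ↦ map_mem_oneLE φ (hf i))
      (fun i ↦ map_mem_oneLE φ (hg i)) hEK
      (by simp only [← map_mul, ← map_sum, ← hE, hE1, map_one])
      (fun i ↦ by rw [coeff_mapRingHom, coeff_mapRingHom, hHb, hgb, hφ])
    refine ⟨K, inferInstance, ψ, φ, fun y ↦ (hψ y).1, hφ, fun i x ↦ ?_, fun i x ↦ ?_⟩
    · have := congrArg (fun z ↦ (z : K[G]).coeff x) (congrFun h1 i)
      simpa only [coeff_mapRingHom] using this
    · have := congrArg (fun z ↦ (z : K[G]).coeff x) (congrFun h2 i)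
      simpa only [coeff_mapRingHom] using this
  constructor
  · intro i x
    obtain ⟨t, ht, r, hr⟩ := hfrac ((f i).coeff x)
    refine ⟨t, ht, r, fun q hq hqp ↦ ?_⟩
    obtain ⟨K, _, ψ, φ, h1, h2, h3, -⟩ := key q hq hqp
    apply h1
    rw [map_sub, map_mul, h2, h2, h3, ← map_mul, hr, sub_self]
  · intro i x
    obtain ⟨t, ht, r, hr⟩ := hfrac ((g i).coeff x)
    refine ⟨t, ht, r, fun q hq hqp ↦ ?_⟩
    obtain ⟨K, _, ψ, φ, h1, h2, -, h4⟩ := key q hq hqp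
    apply h1
    rw [map_sub, map_mul, h2, h2, h4, ← map_mul, hr, sub_self]

/-- Descent of a normalized rank-one factorization from `B` to `R`. -/
theorem algebraMap_surjective_of_rankOne [IsDomain B] {E : ι → ι → R[G]}
    {F H : ι → B[G]} {a b : ι → R} (hinj : Function.Injective (algebraMap R B))
    (hF : ∀ i, F i ∈ oneLE B G) (hH : ∀ i, H i ∈ oneLE B G)
    (hE : ∀ i j, mapRingHom G (algebraMap R B) (E i j) = F i * H j)
    (hFH : ∑ i, F i * H i = 1)
    (hFa : ∀ i, (F i).coeff 1 = algebraMap R B (a i))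
    (hHb : ∀ i, (H i).coeff 1 = algebraMap R B (b i))
    (hadj : Algebra.adjoin R ((Set.range fun p : ι × G ↦ (F p.1).coeff p.2) ∪
      Set.range fun p : ι × G ↦ (H p.1).coeff p.2) = ⊤)
    (hrad : ∀ (y : B) (n : ℕ), y ^ n ∈ conductorIdeal R B → y ∈ conductorIdeal R B) :
    Function.Surjective (algebraMap R B) := by
  have hinjG : Function.Injective (mapRingHom G (algebraMap R B)) :=
    map_injective (algebraMap R B : R →+ B) hinj
  have hEs : ∀ i j, E i j ∈ oneLE R G := fun i j x hx ↦ by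
    refine mul_mem (hF i) (hH j) x ?_
    rw [← hE, coeff_mapRingHom]
    exact fun h ↦ hx (hinj (h.trans (map_zero _).symm))
  have hEr : ∀ i j k l, E i j * E k l = E i l * E k j := fun i j k l ↦ hinjG <| by
    simp only [map_mul, hE]
    ring
  have hE1 : ∑ i, E i i = 1 := hinjG <| by simp only [map_sum, hE, hFH, map_one]
  have hEab : ∀ i j, (E i j).coeff 1 = a i * b j := fun i j ↦ hinj <| by
    rw [← coeff_mapRingHom, hE, coeff_mul_one_of_mem (hF i) (hH j), hFa, hHb, map_mul]
  have hfin : ∀ K : ι → B[G], (Set.range fun p : ι × G ↦ (K p.1).coeff p.2).Finite := by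
    intro K
    refine (Set.finite_iUnion fun i ↦ ((K i).coeff.finite_range)).subset ?_
    rintro _ ⟨⟨i, x⟩, rfl⟩
    exact Set.mem_iUnion.2 ⟨i, x, rfl⟩
  have hab : ∑ i, algebraMap R B (a i) * algebraMap R B (b i) = 1 := by
    have : (∑ i, F i * H i).coeff 1 = 1 := by rw [hFH]; exact coeff_one_one
    rw [coeff_sum, Finsupp.finsetSum_apply] at this
    simpa only [coeff_mul_one_of_mem (hF _) (hH _), hFa, hHb] using this
  have hint : ∀ b ∈ ((Set.range fun p : ι × G ↦ (F p.1).coeff p.2) ∪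
      Set.range fun p : ι × G ↦ (H p.1).coeff p.2), IsIntegral R b := by
    rintro _ (⟨⟨i, x⟩, rfl⟩ | ⟨⟨i, x⟩, rfl⟩)
    · refine isIntegral_coeff_of_mul (F := ∑ j, single 1 (algebraMap R B (a j)) * H j)
        (x₀ := 1) ?_ (fun y ↦ ?_) x
      · rw [coeff_sum, Finsupp.finsetSum_apply]
        simpa only [coeff_single_mul_apply, inv_one, one_mul, hHb] using hab
      · rw [Finset.sum_mul, coeff_sum, Finsupp.finsetSum_apply]
        refine sum_mem fun j _ ↦ ?_
        rw [mul_assoc, mul_comm (H j), ← hE, coeff_single_mul_apply, coeff_mapRingHom, ← map_mul]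
        exact ⟨_, rfl⟩
    · refine isIntegral_coeff_of_mul (F := ∑ j, single 1 (algebraMap R B (b j)) * F j)
        (x₀ := 1) ?_ (fun y ↦ ?_) x
      · rw [coeff_sum, Finsupp.finsetSum_apply]
        simp only [coeff_single_mul_apply, inv_one, one_mul, hFa]
        simpa only [mul_comm] using hab
      · rw [Finset.sum_mul, coeff_sum, Finsupp.finsetSum_apply]
        refine sum_mem fun j _ ↦ ?_
        rw [mul_assoc, ← hE, coeff_single_mul_apply, coeff_mapRingHom, ← map_mul]
        exact ⟨_, rfl⟩
  refine algebraMap_surjective_of_conductorIdeal hrad ((hfin F).union (hfin H)) hadj hint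
    fun p hp ↦ ?_
  obtain ⟨h1, h2⟩ := exists_coeff_sub_mem hEs hEr hE1 hEab hF hH hE hHb p hp
  rintro _ (⟨⟨i, x⟩, rfl⟩ | ⟨⟨i, x⟩, rfl⟩)
  · exact h1 i x
  · exact h2 i x

end Descent

section Graded

variable {K : Type*} [CommRing K] {G : Type*}

theorem sum_support_single (f : K[G]) : ∑ x ∈ f.coeff.support, single x (f.coeff x) = f :=
  sum_coeff_single f

variable [CommGroup G]

/-- The coaction of a group algebra on itself. -/
def coaction : K[G] →+* K[G][G] :=
  (curryRingEquiv (R := K) (M := G) (N := G)).toRingHom.comp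
    (mapDomainRingHom K ((MonoidHom.id G).prod (MonoidHom.id G)))

theorem coaction_single (x : G) (a : K) : coaction (single x a) = single x (single x a) := by
  simp [coaction]

theorem coeff_coaction (f : K[G]) (x : G) : (coaction f).coeff x = single x (f.coeff x) := by
  induction f using MonoidAlgebra.induction_linear with
  | zero => simp
  | add f g hf hg => simp [hf, hg, single_add]
  | single y a =>
    rw [coaction_single, coeff_single, coeff_single, Finsupp.single_apply, Finsupp.single_apply]
    split_ifs with h
    · rw [h]
    · simp

/-- A subring of a group algebra is graded if it contains the homogeneous components of its
elements. -/
def IsGradedSubring (B : Subring K[G]) : Prop :=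
  ∀ f ∈ B, ∀ x, single x (f.coeff x) ∈ B

theorem mem_range_mapRingHom {T S : Type*} [CommRing T] [CommRing S] (φ : T →+* S) (f : S[G]) :
    f ∈ (mapRingHom G φ).range ↔ ∀ x, f.coeff x ∈ φ.range := by
  constructor
  · rintro ⟨y, rfl⟩ x
    rw [coeff_mapRingHom]
    exact ⟨_, rfl⟩
  · intro h
    have hmem : f ∈ Set.range (MonoidAlgebra.map (M := G) (φ : T →+ S)) := by
      rw [range_map]
      exact h
    exact hmem

theorem mem_range_mapRingHom_subtype (B : Subring K[G]) (f : K[G][G]) :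
    f ∈ (mapRingHom G B.subtype).range ↔ ∀ x, f.coeff x ∈ B := by
  rw [mem_range_mapRingHom, Subring.range_subtype]

theorem single_coeff_mul_mem (B : Subring K[G]) {f g : K[G]}
    (hf : ∀ x, single x (f.coeff x) ∈ B) (hg : ∀ x, single x (g.coeff x) ∈ B) (x : G) :
    single x ((f * g).coeff x) ∈ B := by
  simp only [← coeff_coaction] at hf hg ⊢
  rw [← mem_range_mapRingHom_subtype] at hf hg
  revert x
  rw [← mem_range_mapRingHom_subtype, map_mul]
  exact mul_mem hf hg

theorem mul_mem_of_forall_single {R₀ B : Subring K[G]} (hB : IsGradedSubring B) {z : K[G]}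
    (h : ∀ x a, single x a ∈ B → z * single x a ∈ R₀) : ∀ d ∈ B, z * d ∈ R₀ := by
  intro d hd
  rw [← sum_support_single d, Finset.mul_sum]
  exact sum_mem fun x _ ↦ h _ _ (hB d hd x)

theorem single_mul_mem_of_sq {R₀ B : Subring K[G]} (hB : IsGradedSubring B)
    (hsn : ∀ x a, (single x a : K[G]) ^ 2 ∈ R₀ → (single x a : K[G]) ^ 3 ∈ R₀ →
      single x a ∈ R₀) {x : G} {a : K} (hx : single x a ∈ B)
    (h : ∀ d ∈ B, single x a ^ 2 * d ∈ R₀) : ∀ d ∈ B, single x a * d ∈ R₀ := by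
  refine mul_mem_of_forall_single hB fun y b hy ↦ ?_
  have h2 : (single x a * single y b) ^ 2 ∈ R₀ := by
    rw [mul_pow]
    exact h _ (pow_mem hy 2)
  have h3 : (single x a * single y b) ^ 3 ∈ R₀ := by
    have : (single x a * single y b) ^ 3 =
      single x a ^ 2 * (single x a * single y b ^ 3) := by ring
    rw [this]
    exact h _ (mul_mem hx (pow_mem hy 3))
  rw [single_mul_single] at h2 h3 ⊢
  exact hsn _ _ h2 h3

theorem single_mul_mem_of_two_pow {R₀ B : Subring K[G]} (hB : IsGradedSubring B)
    (hsn : ∀ x a, (single x a : K[G]) ^ 2 ∈ R₀ → (single x a : K[G]) ^ 3 ∈ R₀ →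
      single x a ∈ R₀) (k : ℕ) {x : G} {a : K} (hx : single x a ∈ B)
    (h : ∀ d ∈ B, single x a ^ (2 ^ k) * d ∈ R₀) : ∀ d ∈ B, single x a * d ∈ R₀ := by
  induction k generalizing x a with
  | zero => simpa using h
  | succ k ih =>
    refine single_mul_mem_of_sq hB hsn hx ?_
    have hx2 := pow_mem hx 2
    rw [single_pow] at hx2 ⊢
    refine ih hx2 ?_
    rwa [← single_pow, ← pow_mul, ← pow_succ']

theorem single_mul_mem_of_pow {R₀ B : Subring K[G]} (hB : IsGradedSubring B)
    (hsn : ∀ x a, (single x a : K[G]) ^ 2 ∈ R₀ → (single x a : K[G]) ^ 3 ∈ R₀ →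
      single x a ∈ R₀) (n : ℕ) {x : G} {a : K} (hx : single x a ∈ B)
    (h : ∀ d ∈ B, single x a ^ n * d ∈ R₀) : ∀ d ∈ B, single x a * d ∈ R₀ := by
  refine single_mul_mem_of_two_pow hB hsn n hx fun d hd ↦ ?_
  rw [← Nat.add_sub_cancel' n.lt_two_pow_self.le, pow_add, mul_assoc]
  exact h _ (mul_mem (pow_mem hx _) hd)

variable [LinearOrder G] [IsOrderedMonoid G]

theorem coeff_pow_of_forall_ge {f : K[G]} {a : G} (hf : ∀ x, f.coeff x ≠ 0 → x ≤ a) (n : ℕ) :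
    (f ^ n).coeff (a ^ n) = f.coeff a ^ n ∧ ∀ x, (f ^ n).coeff x ≠ 0 → x ≤ a ^ n := by
  induction n with
  | zero =>
    simp only [pow_zero, coeff_one_one, true_and]
    intro x hx
    rw [one_def, coeff_single, Finsupp.single_apply] at hx
    split_ifs at hx with h
    · exact h.ge
    · exact absurd rfl hx
  | succ n ih =>
    simp only [pow_succ]
    refine ⟨by rw [coeff_mul_of_forall_ge ih.2 hf, ih.1], fun x hx ↦ ?_⟩
    obtain ⟨b, c, hb, hc, rfl⟩ := exists_of_coeff_mul_ne_zero hx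
    exact mul_le_mul' (ih.2 b hb) (hf c hc)

theorem mul_mem_of_pow {R₀ B : Subring K[G]} (hR : IsGradedSubring R₀) (hB : IsGradedSubring B)
    (hsn : ∀ x a, (single x a : K[G]) ^ 2 ∈ R₀ → (single x a : K[G]) ^ 3 ∈ R₀ →
      single x a ∈ R₀) (n : ℕ) {y : K[G]} (hy : y ∈ B) (h : ∀ d ∈ B, y ^ n * d ∈ R₀) :
    ∀ d ∈ B, y * d ∈ R₀ := by
  induction hk : y.coeff.support.card using Nat.strong_induction_on generalizing y with
  | _ k ih =>
    by_cases hy0 : y = 0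
    · simp [hy0, zero_mem]
    obtain ⟨x, hx, hxmax⟩ := exists_max_support hy0
    have hmem := hB y hy x
    have htop : ∀ d ∈ B, single x (y.coeff x) * d ∈ R₀ := by
      refine single_mul_mem_of_pow hB hsn n hmem ?_
      refine mul_mem_of_forall_single hB fun z a hz ↦ ?_
      have := hR _ (h _ hz) (x ^ n * z)
      rwa [coeff_mul_single_apply, mul_inv_cancel_right, (coeff_pow_of_forall_ge hxmax n).1,
        ← single_mul_single, ← single_pow] at this
    intro d hd
    have hsub : ∀ d ∈ B, (y - single x (y.coeff x)) * d ∈ R₀ := by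
      refine ih _ ?_ (sub_mem hy hmem) (fun d hd ↦ ?_) rfl
      · rw [← hk]
        refine Finset.card_lt_card ((Finset.ssubset_iff_of_subset fun z hz ↦ ?_).2
          ⟨x, Finsupp.mem_support_iff.2 hx, by simp⟩)
        rw [Finsupp.mem_support_iff] at hz ⊢
        intro hz0
        apply hz
        rw [coeff_sub, Finsupp.sub_apply, hz0, coeff_single, Finsupp.single_apply]
        split_ifs with hxz
        · rw [hxz, hz0, sub_zero]
        · exact sub_zero _
      · obtain ⟨c, hc⟩ : ∃ c ∈ B, (y - single x (y.coeff x)) ^ n =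
            y ^ n - single x (y.coeff x) * c := by
          let u : B := ⟨y, hy⟩
          let w : B := ⟨single x (y.coeff x), hmem⟩
          obtain ⟨c, hc⟩ := sub_dvd_pow_sub_pow u (u - w) n
          refine ⟨c, c.2, ?_⟩
          have := congrArg B.subtype hc
          simp only [map_sub, map_mul, map_pow, sub_sub_cancel, Subring.subtype_apply, u, w]
            at this
          rw [← this, sub_sub_cancel]
        rw [hc.2, sub_mul, mul_assoc]
        exact sub_mem (h d hd) (htop _ (mul_mem hc.1 hd))
    have := add_mem (hsub d hd) (htop d hd)
    rwa [← add_mul, sub_add_cancel] at this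

end Graded

section Core

variable {K : Type*} [Field K] {G : Type*} [CommGroup G]

theorem isGradedSubring_adjoin {R₀ : Subring K[G]} (hR : IsGradedSubring R₀) {s : Set K[G]}
    (hs : ∀ f ∈ s, ∃ x a, f = single x a) :
    IsGradedSubring (Algebra.adjoin R₀ s).toSubring := by
  intro f hf
  change f ∈ Algebra.adjoin R₀ s at hf
  induction hf using Algebra.adjoin_induction with
  | mem f hf =>
    intro x
    obtain ⟨y, a, rfl⟩ := hs f hf
    rw [coeff_single, Finsupp.single_apply]
    split_ifs with h
    · rw [← h]
      exact Algebra.subset_adjoin hf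
    · rw [single_zero]
      exact zero_mem _
  | algebraMap r => exact fun x ↦ (Algebra.adjoin R₀ s).algebraMap_mem ⟨_, hR r r.2 x⟩
  | add f g _ _ hf hg =>
    intro x
    rw [coeff_add, Finsupp.add_apply, single_add]
    exact add_mem (hf x) (hg x)
  | mul f g _ _ hf hg => exact single_coeff_mul_mem _ hf hg

variable [LinearOrder G] [IsOrderedMonoid G]

/-- The factors of a normalized rank-one factorization over a graded subring that is seminormal
with respect to homogeneous elements lie in that subring. -/
theorem mem_of_rankOne {R₀ : Subring K[G]} (hR : IsGradedSubring R₀)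
    (hsn : ∀ x a, (single x a : K[G]) ^ 2 ∈ R₀ → (single x a : K[G]) ^ 3 ∈ R₀ →
      single x a ∈ R₀) {ι : Type*} [Fintype ι] {f g : ι → K[G]} (hf : ∀ i, f i ∈ oneLE K G)
    (hg : ∀ i, g i ∈ oneLE K G) (hfg : ∀ i j, f i * g j ∈ R₀) (h1 : ∑ i, f i * g i = 1)
    (hfa : ∀ i, single 1 ((f i).coeff 1) ∈ R₀) (hgb : ∀ i, single 1 ((g i).coeff 1) ∈ R₀) :
    (∀ i, f i ∈ R₀) ∧ ∀ i, g i ∈ R₀ := by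
  let s : Set K[G] := (Set.range fun p : ι × G ↦ single p.2 ((f p.1).coeff p.2)) ∪
    Set.range fun p : ι × G ↦ single p.2 ((g p.1).coeff p.2)
  let B := Algebra.adjoin R₀ s
  have hB : IsGradedSubring B.toSubring := isGradedSubring_adjoin hR <| by
    rintro _ (⟨p, rfl⟩ | ⟨p, rfl⟩) <;> exact ⟨_, _, rfl⟩
  let v : B →+* K[G] := B.val
  have hv : Function.Injective v := Subtype.val_injective
  have hvG : Function.Injective (mapRingHom G v) := map_injective (v : B →+ K[G]) hv
  have hlift : ∀ h : ι → K[G], (∀ i x, single x ((h i).coeff x) ∈ s) → (∀ i, h i ∈ oneLE K G) →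
      ∃ F : ι → B[G], (∀ i, mapRingHom G v (F i) = coaction (h i)) ∧
        (∀ i x, v ((F i).coeff x) = single x ((h i).coeff x)) ∧ ∀ i, F i ∈ oneLE B G := by
    intro h hh hh1
    have : ∀ i, ∃ F : B[G], mapRingHom G v F = coaction (h i) := by
      intro i
      refine (mem_range_mapRingHom v _).2 fun x ↦ ?_
      rw [coeff_coaction]
      exact ⟨⟨_, Algebra.subset_adjoin (hh i x)⟩, rfl⟩
    choose F hF using this
    have hF' : ∀ i x, v ((F i).coeff x) = single x ((h i).coeff x) := fun i x ↦ by
      rw [← coeff_coaction, ← hF, coeff_mapRingHom]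
    refine ⟨F, hF, hF', fun i x hx ↦ hh1 i x fun h0 ↦ hx (hv ?_)⟩
    rw [hF', h0, single_zero, map_zero]
  obtain ⟨F, hF, hF', hF1⟩ := hlift f (fun i x ↦ Or.inl ⟨(i, x), rfl⟩) hf
  obtain ⟨H, hH, hH', hH1⟩ := hlift g (fun i x ↦ Or.inr ⟨(i, x), rfl⟩) hg
  have hE : ∀ i j, ∃ E : R₀[G], mapRingHom G R₀.subtype E = coaction (f i * g j) := fun i j ↦
    (mem_range_mapRingHom_subtype R₀ _).2 fun x ↦ by
      rw [coeff_coaction]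
      exact hR _ (hfg i j) x
  choose E hE using hE
  have hcomp : v.comp (algebraMap R₀ B) = R₀.subtype := rfl
  have hsurj : Function.Surjective (algebraMap R₀ B) := by
    refine algebraMap_surjective_of_rankOne (E := E) (F := F) (H := H)
      (a := fun i ↦ ⟨_, hfa i⟩) (b := fun i ↦ ⟨_, hgb i⟩)
      (fun x y h ↦ Subtype.val_injective (congrArg v h))
      hF1 hH1 (fun i j ↦ hvG ?_) (hvG ?_) (fun i ↦ hv (hF' i 1)) (fun i ↦ hv (hH' i 1)) ?_ ?_
    · rw [← RingHom.comp_apply, ← mapRingHom_comp, hcomp, hE, map_mul, map_mul, hF, hH]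
    · simp only [map_sum, map_mul, hF, hH, map_one]
      simp only [← map_mul, ← map_sum, h1, map_one]
    · have : ((Set.range fun p : ι × G ↦ (F p.1).coeff p.2) ∪
          Set.range fun p : ι × G ↦ (H p.1).coeff p.2) = ((↑) : B → K[G]) ⁻¹' s := by
        ext y
        refine or_congr (exists_congr fun p ↦ ?_) (exists_congr fun p ↦ ?_)
        · beta_reduce
          rw [← hF', ← hv.eq_iff]
          rfl
        · beta_reduce
          rw [← hH', ← hv.eq_iff]
          rfl
      rw [this]
      exact Algebra.adjoin_adjoin_coe_preimage
    · intro y n hy d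
      have hy' : ∀ d ∈ B.toSubring, (y : K[G]) ^ n * d ∈ R₀ := by
        intro d hd
        obtain ⟨r, hr⟩ := hy ⟨d, hd⟩
        have := congrArg v hr
        rw [map_mul, map_pow] at this
        have hr' : (r : K[G]) = (y : K[G]) ^ n * d := this
        exact hr' ▸ r.2
      exact ⟨⟨_, mul_mem_of_pow hR hB hsn n y.2 hy' d d.2⟩, hv rfl⟩
  have hmem : ∀ b : B, (b : K[G]) ∈ R₀ := by
    intro b
    obtain ⟨r, rfl⟩ := hsurj b
    exact r.2
  constructor
  · intro i
    rw [← sum_support_single (f i)]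
    exact sum_mem fun x _ ↦ (hF' i x) ▸ hmem _
  · intro i
    rw [← sum_support_single (g i)]
    exact sum_mem fun x _ ↦ (hH' i x) ▸ hmem _

end Core

section MonoidSubalgebra

variable {A : Type*} [CommRing A] {G : Type*} [CommGroup G] (M : Submonoid G)

/-- The canonical map from the monoid algebra over `A` to the group algebra over `K`. -/
def toGroupAlgebra (K : Type*) [CommRing K] [Algebra A K] : A[M] →+* K[G] :=
  (mapRingHom G (algebraMap A K)).comp (mapDomainRingHom A M.subtype)

theorem toGroupAlgebra_single (K : Type*) [CommRing K] [Algebra A K] (x : M) (a : A) :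
    toGroupAlgebra M K (single x a) = single (x : G) (algebraMap A K a) := by
  simp [toGroupAlgebra]

theorem toGroupAlgebra_injective (K : Type*) [CommRing K] [Algebra A K]
    (h : Function.Injective (algebraMap A K)) : Function.Injective (toGroupAlgebra (A := A) M K) :=
  (map_injective (algebraMap A K : A →+ K) h).comp (mapDomain_injective Subtype.val_injective)

theorem mem_range_toGroupAlgebra {K : Type*} [CommRing K] [Algebra A K] {f : K[G]} :
    f ∈ (toGroupAlgebra (A := A) M K).range ↔
      ∀ x, f.coeff x ∈ (algebraMap A K).range ∧ (f.coeff x ≠ 0 → x ∈ M) := by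
  constructor
  · rintro ⟨f, rfl⟩
    induction f using MonoidAlgebra.induction_linear with
    | zero => simp [zero_mem]
    | add f g hf hg =>
      intro x
      rw [map_add, coeff_add, Finsupp.add_apply]
      refine ⟨add_mem (hf x).1 (hg x).1, fun h ↦ ?_⟩
      by_contra hx
      exact h (by rw [not_not.1 (mt (hf x).2 hx), not_not.1 (mt (hg x).2 hx), add_zero])
    | single y a =>
      intro x
      rw [toGroupAlgebra_single, coeff_single, Finsupp.single_apply]
      split_ifs with h
      · exact ⟨⟨a, rfl⟩, fun _ ↦ h ▸ y.2⟩
      · exact ⟨zero_mem _, fun h ↦ absurd rfl h⟩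
  · intro h
    rw [← sum_support_single f]
    refine sum_mem fun x hx ↦ ?_
    obtain ⟨⟨a, ha⟩, hM⟩ := h x
    exact ⟨single ⟨x, hM (Finsupp.mem_support_iff.1 hx)⟩ a, by rw [toGroupAlgebra_single, ha]⟩

theorem single_mem_range_toGroupAlgebra {K : Type*} [CommRing K] [Algebra A K] {x : G} {a : K} :
    single x a ∈ (toGroupAlgebra (A := A) M K).range ↔
      a ∈ (algebraMap A K).range ∧ (a ≠ 0 → x ∈ M) := by
  rw [mem_range_toGroupAlgebra]
  constructor
  · intro h
    simpa using h x
  · intro h y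
    rw [coeff_single, Finsupp.single_apply]
    split_ifs with hxy
    · exact hxy ▸ h
    · exact ⟨zero_mem _, fun h ↦ absurd rfl h⟩

theorem coeff_toGroupAlgebra {K : Type*} [CommRing K] [Algebra A K] (f : A[M]) (x : M) :
    (toGroupAlgebra M K f).coeff x = algebraMap A K (f.coeff x) := by
  induction f using MonoidAlgebra.induction_linear with
  | zero => simp
  | add f g hf hg => simp [hf, hg]
  | single y a =>
    rw [toGroupAlgebra_single, coeff_single, coeff_single, Finsupp.single_apply,
      Finsupp.single_apply]
    simp only [Subtype.coe_inj]
    split_ifs <;> simp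

/-- Over a seminormal domain and a positive seminormal monoid, a rank-one idempotent matrix whose
constant part factors is itself a product of a column and a row. -/
theorem exists_factorization_of_rankOne [IsDomain A]
    (hA : ∀ x : FractionRing A, x ^ 2 ∈ (algebraMap A (FractionRing A)).range →
      x ^ 3 ∈ (algebraMap A (FractionRing A)).range → x ∈ (algebraMap A (FractionRing A)).range)
    (htf : MulTorsionFree G) (hpos : ∀ x ∈ M, x⁻¹ ∈ M → x = 1)
    (hsn : ∀ g : G, g ^ 2 ∈ M → g ^ 3 ∈ M → g ∈ M) {ι : Type*} [Fintype ι] (e : ι → ι → A[M])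
    (he : ∀ i j k l, e i j * e k l = e i l * e k j) (h1 : ∑ i, e i i = 1) {a b : ι → A}
    (hab : ∀ i j, (e i j).coeff 1 = a i * b j) :
    ∃ f g : ι → A[M], ∀ i j, e i j = f i * g j := by
  obtain ⟨_, _, hM⟩ := exists_linearOrder_one_le htf M hpos
  let K := FractionRing A
  let ρ : A[M] →+* K[G] := toGroupAlgebra M K
  have hρ : Function.Injective ρ := toGroupAlgebra_injective M K (IsFractionRing.injective A K)
  have hone : ∀ f ∈ ρ.range, f ∈ oneLE K G := fun f hf x hx ↦
    hM x (((mem_range_toGroupAlgebra M).1 hf x).2 hx)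
  obtain ⟨f, g, hf, hg, hfg, hfa, hgb⟩ := exists_normalized_factorization
    (fun i j ↦ ρ (e i j)) (fun i j ↦ hone _ ⟨_, rfl⟩)
    (fun i j k l ↦ by rw [← map_mul, he, map_mul]) (by rw [← map_sum, h1, map_one])
    (a := fun i ↦ algebraMap A K (a i)) (b := fun i ↦ algebraMap A K (b i))
    (fun i j ↦ by rw [← map_mul, ← hab, ← coeff_toGroupAlgebra]; rfl)
  have hR : IsGradedSubring ρ.range := fun f hf x ↦
    (single_mem_range_toGroupAlgebra M).2 ((mem_range_toGroupAlgebra M).1 hf x)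
  have hsnR : ∀ (x : G) (c : K), single x c ^ 2 ∈ ρ.range → single x c ^ 3 ∈ ρ.range →
      single x c ∈ ρ.range := by
    intro x c h2 h3
    rw [single_pow] at h2 h3
    have h2 := (single_mem_range_toGroupAlgebra M).1 h2
    have h3 := (single_mem_range_toGroupAlgebra M).1 h3
    exact (single_mem_range_toGroupAlgebra M).2 ⟨hA c h2.1 h3.1, fun hc ↦
      hsn x (h2.2 (pow_ne_zero _ hc)) (h3.2 (pow_ne_zero _ hc))⟩
  obtain ⟨hf', hg'⟩ := mem_of_rankOne hR hsnR hf hg (fun i j ↦ ⟨_, hfg i j⟩)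
    (by simp only [← hfg, ← map_sum, h1, map_one])
    (fun i ↦ (single_mem_range_toGroupAlgebra M).2 ⟨⟨_, (hfa i).symm⟩, fun _ ↦ one_mem M⟩)
    (fun i ↦ (single_mem_range_toGroupAlgebra M).2 ⟨⟨_, (hgb i).symm⟩, fun _ ↦ one_mem M⟩)
  choose f' hf' using hf'
  choose g' hg' using hg'
  exact ⟨f', g', fun i j ↦ hρ (by rw [map_mul, hf', hg', ← hfg])⟩

end MonoidSubalgebra

section Modules

open TensorProduct

theorem exists_sum_dual_eq_one (R P : Type*) [CommRing R] [AddCommGroup P] [Module R P]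
    [Module.Invertible R P] :
    ∃ (n : ℕ) (x : Fin n → P) (y : Fin n → Module.Dual R P), ∑ i, y i (x i) = 1 := by
  obtain ⟨t, ht⟩ := (Module.Invertible.linearEquiv R P).surjective 1
  obtain ⟨n, y, x, rfl⟩ := TensorProduct.exists_sum_tmul_eq t
  refine ⟨n, x, y, ?_⟩
  rw [← ht, map_sum]
  rfl

/-- If suitable rank-one idempotent matrices over `R` factor, an invertible `R`-module is free as
soon as its base change to `A` is. -/
theorem nonempty_linearEquiv_of_factorization {R A P : Type*} [CommRing R] [CommRing A]
    [Algebra R A] [AddCommGroup P] [Module R P] [Module.Invertible R P]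
    (hfac : ∀ (n : ℕ) (e : Fin n → Fin n → R) (a b : Fin n → A),
      (∀ i j k l, e i j * e k l = e i l * e k j) → ∑ i, e i i = 1 →
      (∀ i j, algebraMap R A (e i j) = a i * b j) →
      ∃ f g : Fin n → R, ∀ i j, e i j = f i * g j)
    (φ : (A ⊗[R] P) ≃ₗ[A] A) : Nonempty (P ≃ₗ[R] R) := by
  obtain ⟨n, x, y, hxy⟩ := exists_sum_dual_eq_one R P
  have hcomm : ∀ (z w : Module.Dual R P) (u v : P), z u * w v = z v * w u := fun z w u v ↦ by
    simpa using congrArg (LinearMap.mul' R R ∘ₗ TensorProduct.map z w)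
      (Module.Invertible.tmul_comm (R := R) (m₁ := u) (m₂ := v))
  have hexp : ∀ u : P, u = ∑ i, y i u • x i := fun u ↦ by
    have h : ∀ i, y i (x i) • u = y i u • x i := fun i ↦ by
      simpa using congrArg ((TensorProduct.lid R P).toLinearMap ∘ₗ (y i).rTensor P)
        (Module.Invertible.tmul_comm (R := R) (m₁ := x i) (m₂ := u))
    simp only [← h, ← Finset.sum_smul, hxy, one_smul]
  obtain ⟨f, g, hfg⟩ := hfac n (fun i j ↦ y j (x i)) (fun i ↦ φ (1 ⊗ₜ x i))
    (fun j ↦ (y j).baseChange A (φ.symm 1)) (fun i j k l ↦ by rw [hcomm, mul_comm])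
    hxy (fun i j ↦ by
      rw [← smul_eq_mul, ← map_smul, ← map_smul, smul_eq_mul, mul_one,
        LinearEquiv.symm_apply_apply, Module.Dual.baseChange_apply_tmul, Algebra.algebraMap_eq_smul_one])
  let t := ∑ j, g j • x j
  have hx : ∀ i, x i = f i • t := fun i ↦ by
    rw [Finset.smul_sum]
    conv_lhs => rw [hexp (x i)]
    simp only [hfg, mul_smul]
  have hsurj : Function.Surjective (LinearMap.toSpanSingleton R P t) := fun u ↦ by
    refine ⟨∑ i, y i u * f i, ?_⟩
    rw [LinearMap.toSpanSingleton_apply, Finset.sum_smul]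
    conv_rhs => rw [hexp u]
    simp only [mul_smul, ← hx]
  exact ⟨(LinearEquiv.ofBijective _ (Module.Invertible.bijective_of_surjective hsurj)).symm⟩

end Modules

section Picard

/-- The Picard group defined through categories of modules agrees with that of Mathlib. -/
def ringPicEquiv (R : Type u) [CommRing R] : RingPic R ≃* CommRing.Pic R :=
  (Units.mapEquiv (Skeleton.mulEquiv ModuleCat.equivalenceSemimoduleCat)).trans
    (equivShrink (Skeleton (SemimoduleCat.{u} R))ˣ).symm.mulEquiv.symm

/-- The augmentation of the monoid algebra of a positive monoid, sending nontrivial monoid elements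
to zero. -/
def augmentation {A G : Type*} [CommRing A] [CommGroup G] (M : Submonoid G)
    (hpos : ∀ x ∈ M, x⁻¹ ∈ M → x = 1) : A[M] →ₐ[A] A :=
  MonoidAlgebra.lift A A M
    { toFun x := if x = 1 then 1 else 0
      map_one' := if_pos rfl
      map_mul' x y := by
        by_cases hx : x = 1
        · simp [hx]
        · rw [if_neg hx, zero_mul, if_neg]
          intro hxy
          refine hx (Subtype.ext (hpos x x.2 ?_))
          rw [inv_eq_of_mul_eq_one_right (b := (y : G)) (congrArg Subtype.val hxy)]
          exact y.2 }

theorem augmentation_apply {A G : Type*} [CommRing A] [CommGroup G] (M : Submonoid G)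
    (hpos : ∀ x ∈ M, x⁻¹ ∈ M → x = 1) (f : A[M]) : augmentation M hpos f = f.coeff 1 := by
  induction f using MonoidAlgebra.induction_linear with
  | zero => simp
  | add f g hf hg => simp [hf, hg]
  | single x a => simp [augmentation, Finsupp.single_apply]

/-- A retraction of rings through which invertible modules can be detected to be free induces an
isomorphism of Picard groups. -/
theorem pic_mapRingHom_bijective {R A : Type u} [CommRing R] [CommRing A] [Algebra A R]
    (ε : R →ₐ[A] A)
    (hfac : ∀ (n : ℕ) (e : Fin n → Fin n → R) (a b : Fin n → A),
      (∀ i j k l, e i j * e k l = e i l * e k j) → ∑ i, e i i = 1 →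
      (∀ i j, ε (e i j) = a i * b j) → ∃ f g : Fin n → R, ∀ i j, e i j = f i * g j) :
    Function.Bijective (CommRing.Pic.mapRingHom (ε : R →+* A)) := by
  constructor
  · rw [injective_iff_map_eq_one]
    intro P hP
    let := (ε : R →+* A).toAlgebra
    have hP' : CommRing.Pic.mk A (TensorProduct R A P) = 1 := hP
    obtain ⟨φ⟩ := CommRing.Pic.mk_eq_one_iff.1 hP'
    rw [← CommRing.Pic.mk_eq_self (M := P)]
    exact CommRing.Pic.mk_eq_one_iff.2 (nonempty_linearEquiv_of_factorization hfac φ)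
  · intro P
    refine ⟨CommRing.Pic.mapRingHom (algebraMap A R) P, ?_⟩
    rw [CommRing.Pic.mapRingHom_mapRingHom, AlgHom.comp_algebraMap]
    exact CommRing.Pic.mapRingHom_id_apply

end Picard

end PicardProof

/-- **Sarwar, Remark 3.6 (cf. Bruns–Gubeladze, Theorem 8.42; Anderson).**
Let `A` be a seminormal integral domain (an integral domain subintegrally closed in its field
of fractions) and let `M` be a positive commutative cancellative torsion-free seminormal
monoid, realized as a submonoid of its torsion-free group of fractions `G = gp(M)` in which
`M` is subintegrally closed.  Then `Pic(A) ≅ Pic(A[M])`. -/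
theorem ringPic_monoidAlgebra_iso
    {A : Type u} [CommRing A] [IsDomain A]
    (hA : ∀ x : FractionRing A,
      x ^ 2 ∈ (algebraMap A (FractionRing A)).range →
      x ^ 3 ∈ (algebraMap A (FractionRing A)).range →
      x ∈ (algebraMap A (FractionRing A)).range)
    {G : Type u} [CommGroup G] (htf : MulTorsionFree G) (M : Submonoid G)
    (hgp : ∀ g : G, ∃ a ∈ M, ∃ b ∈ M, g = a * b⁻¹)
    (hpos : ∀ x ∈ M, x⁻¹ ∈ M → x = 1)
    (hsn : ∀ g : G, g ^ 2 ∈ M → g ^ 3 ∈ M → g ∈ M) :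
    Nonempty (RingPic A ≃* RingPic (MonoidAlgebra A M)) := by
  refine ⟨(ringPicEquiv A).trans ((MulEquiv.ofBijective _ (pic_mapRingHom_bijective
    (augmentation M hpos) fun n e a b he h1 hab ↦ ?_)).symm.trans (ringPicEquiv _).symm)⟩
  exact exists_factorization_of_rankOne M hA htf hpos hsn e he h1 fun i j ↦ by
    rw [← hab, augmentation_apply]
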